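/- For every integer r ≥ 1, Σ_{j=1}^{r} Σ_{m=1}^{j} (-1)^(m-1) · (m! · (m-1)! / (2m+1)!) · C(2r+2, 2j) · R(j,m) = r, as an identity of rational numbers. -/

import Mathlib

/-- `R j m = ∑_{i=0}^m (-1)^i C(2m, i) (m-i)^{2j}`, the sequence A304330. -/
def R (j m : ℕ) : ℤ :=
  ∑ i ∈ Finset.range (m + 1),
    (-1 : ℤ) ^ i * ((2 * m).choose i : ℤ) * (((m - i) ^ (2 * j) : ℕ) : ℤ)

open Finset in
lemma R_succ (j m : ℕ) :
    R (j + 1) (m + 1) = ((m : ℤ) + 1) ^ 2 * R j (m + 1)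
      + (2 * m + 2) * (2 * m + 1) * R j m := by
  unfold R
  rw [sum_range_succ' _ (m + 1), sum_range_succ' _ (m + 1), mul_add (((m : ℤ) + 1) ^ 2), mul_sum, mul_sum,
    add_right_comm, ← sum_add_distrib]
  congr 1
  · apply sum_congr rfl
    intro i hi
    have hi : i ≤ m := by simpa [Nat.lt_succ_iff] using hi
    obtain ⟨t, rfl⟩ := Nat.exists_eq_add_of_le hi
    have h1 : i + t + 1 - (i + 1) = t := by omega
    have h2 : i + t - i = t := by omega
    rw [h1, h2]
    have key : ((i : ℤ) + 1) * (2 * t + i + 1) * ((2 * (i + t + 1)).choose (i + 1) : ℤ)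
        = (2 * (i + t) + 2) * (2 * (i + t) + 1) * ((2 * (i + t)).choose i : ℤ) := by
      have a := Nat.add_one_mul_choose_eq (2 * (i + t) + 1) i
      have b := Nat.choose_mul_succ_eq (2 * (i + t)) i
      have e : 2 * (i + t) + 1 - i = 2 * t + i + 1 := by omega
      rw [e] at b
      have e2 : 2 * (i + t + 1) = 2 * (i + t) + 1 + 1 := by ring
      rw [e2]
      zify at a b
      linear_combination (-(2 * (t : ℤ) + i + 1)) * a - (2 * ((i : ℤ) + t) + 2) * b
    push_cast
    rw [pow_succ (-1 : ℤ) i, mul_add 2 j 1, pow_add]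
    linear_combination (-1 : ℤ) ^ i * (t : ℤ) ^ (2 * j) * key
  · push_cast
    simp
    ring

lemma R_one (j : ℕ) : R (j + 1) 1 = 1 := by
  simp [R, Finset.sum_range_succ]

lemma R_zero (j : ℕ) : R (j + 1) 0 = 0 := by
  simp [R]

/-- Central difference at zero. -/
def cdiff (f : ℤ → ℤ) (m : ℕ) : ℤ := (fwdDiff (1 : ℤ))^[2 * m] f (-(m : ℤ))

open Finset in
lemma cdiff_eq (f : ℤ → ℤ) (m : ℕ) :
    cdiff f m = ∑ k ∈ range (2 * m + 1),
      ((-1 : ℤ) ^ k * (2 * m).choose k) * f (-(m : ℤ) + k) := by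
  unfold cdiff
  rw [fwdDiff_iter_eq_sum_shift]
  apply sum_congr rfl
  intro k hk
  have hk : k ≤ 2 * m := by simpa [Nat.lt_succ_iff] using hk
  have : (-1 : ℤ) ^ (2 * m - k) = (-1) ^ k := by
    apply neg_one_pow_congr
    rw [Nat.even_sub hk]
    simp
  rw [this]
  simp

open Finset in
lemma cdiff_pow (j m : ℕ) : cdiff (fun x => x ^ (2 * (j + 1))) m = 2 * R (j + 1) m := by
  rw [cdiff_eq, show 2 * m + 1 = (m + 1) + m by ring, sum_range_add, two_mul (R _ _)]
  congr 1
  · unfold R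
    apply sum_congr rfl
    intro i hi
    have hi : i ≤ m := by simpa [Nat.lt_succ_iff] using hi
    push_cast [hi]
    rw [show (-(m : ℤ) + i) = -(m - i) by ring, (even_two_mul _).neg_pow]
  · unfold R
    rw [sum_range_succ, ← sum_range_reflect]
    simp only [Nat.sub_self]
    rw [zero_pow (by omega)]
    simp only [Nat.cast_zero, mul_zero, add_zero]
    apply sum_congr rfl
    intro i hi
    have hi : i < m := by simpa using hi
    have e : m + 1 + (m - 1 - i) = 2 * m - i := by omega
    rw [e, Nat.choose_symm (by omega)]
    have : (-1 : ℤ) ^ (2 * m - i) = (-1) ^ i := by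
      apply neg_one_pow_congr
      rw [Nat.even_sub (by omega)]
      simp
    rw [this, Nat.cast_sub (by omega), Nat.cast_pow, Nat.cast_sub hi.le]
    push_cast
    congr 2
    ring

lemma R_eq_zero (j m : ℕ) (h : j + 1 < m) : R (j + 1) m = 0 := by
  have h1 := cdiff_pow j m
  unfold cdiff at h1
  rw [fwdDiff_iter_pow_eq_zero_of_lt (by omega)] at h1
  simp at h1
  omega

open Finset in
lemma sum_even_odd (f : ℕ → ℤ) (n : ℕ) :
    ∑ k ∈ range (2 * n + 1), f k
      = ∑ j ∈ range (n + 1), f (2 * j) + ∑ j ∈ range n, f (2 * j + 1) := by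
  induction n with
  | zero => simp
  | succ n ih =>
    rw [show 2 * (n + 1) + 1 = 2 * n + 1 + 1 + 1 by ring, sum_range_succ, sum_range_succ, ih,
      sum_range_succ _ (n + 1), sum_range_succ _ n, sum_range_succ _ n]
    rw [show 2 * (n + 1) = 2 * n + 1 + 1 by ring]
    ring

open Finset in
lemma even_binom (x : ℤ) (n : ℕ) :
    (x + 1) ^ (2 * n) + (x - 1) ^ (2 * n)
      = 2 * ∑ j ∈ range (n + 1), ((2 * n).choose (2 * j) : ℤ) * x ^ (2 * j) := by
  have h : (x - 1) ^ (2 * n) = (-x + 1) ^ (2 * n) := by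
    rw [← (even_two_mul n).neg_pow]
    congr 1
    ring
  rw [h, add_pow, add_pow, sum_even_odd, sum_even_odd]
  have h1 : ∀ j, (-x) ^ (2 * j) = x ^ (2 * j) := fun j => (even_two_mul j).neg_pow x
  simp only [pow_succ, h1, one_pow, mul_one]
  simp only [mul_neg, neg_mul, sum_neg_distrib]
  simp only [mul_comm _ (Nat.cast _)]
  ring

open Finset in
lemma inner_binom_sum (x : ℤ) (r : ℕ) :
    2 * ∑ j ∈ range r, ((2 * r + 2).choose (2 * (j + 1)) : ℤ) * x ^ (2 * (j + 1))
      = (x + 1) ^ (2 * (r + 1)) + (x - 1) ^ (2 * (r + 1)) - 2 * x ^ (2 * (r + 1)) - 2 := by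
  rw [even_binom, sum_range_succ, sum_range_succ', show 2 * r + 2 = 2 * (r + 1) by ring]
  simp
  ring

open Finset in
lemma cdiff_succ (f : ℤ → ℤ) (m : ℕ) :
    cdiff (fun x => f (x + 1) + f (x - 1) - 2 * f x) m = cdiff f (m + 1) := by
  have h : (fun x => f (x + 1) + f (x - 1) - 2 * f x)
      = fun x => ((fwdDiff (1 : ℤ))^[2] f) (x + (-1)) := by
    ext x
    simp only [Function.iterate_succ, Function.iterate_zero, Function.comp, id, fwdDiff]
    rw [show x + -1 + 1 + 1 = x + 1 by ring, show x + -1 + 1 = x by ring, ← sub_eq_add_neg]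
    ring
  unfold cdiff
  rw [h, fwdDiff_iter_comp_add, ← Function.iterate_add_apply,
    show 2 * (m + 1) = 2 * m + 2 by ring,
    show (-((m + 1 : ℕ) : ℤ)) = -(m : ℤ) + -1 by push_cast; ring]

open Finset in
lemma cdiff_two (m : ℕ) : cdiff (fun _ => 2) (m + 1) = 0 := by
  rw [← cdiff_succ]
  rw [cdiff_eq]
  simp

open Finset in
lemma cdiff_sub (f g : ℤ → ℤ) (m : ℕ) :
    cdiff (fun x => f x - g x) m = cdiff f m - cdiff g m := by
  simp only [cdiff_eq, ← sum_sub_distrib, mul_sub]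

open Finset in
lemma R_binom (r m : ℕ) :
    2 * ∑ j ∈ range r, ((2 * r + 2).choose (2 * (j + 1)) : ℤ) * R (j + 1) (m + 1)
      = R (r + 1) (m + 2) := by
  have h := cdiff_pow r (m + 2)
  rw [← cdiff_succ] at h
  have h2 := cdiff_sub (fun x => (x + 1) ^ (2 * (r + 1)) + (x - 1) ^ (2 * (r + 1))
    - 2 * x ^ (2 * (r + 1))) (fun _ => 2) (m + 1)
  rw [cdiff_two, h] at h2
  simp only [← inner_binom_sum] at h2
  have h3 : cdiff (fun x => 2 * ∑ j ∈ range r,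
      ((2 * r + 2).choose (2 * (j + 1)) : ℤ) * x ^ (2 * (j + 1))) (m + 1)
      = 2 * ∑ j ∈ range r, ((2 * r + 2).choose (2 * (j + 1)) : ℤ) * (2 * R (j + 1) (m + 1)) := by
    simp only [← cdiff_pow]
    simp only [cdiff_eq, mul_sum]
    rw [sum_comm]
    refine sum_congr rfl fun _ _ => sum_congr rfl fun _ _ => ?_
    ring
  rw [h3] at h2
  simp only [mul_left_comm _ (2 : ℤ), ← mul_sum] at h2
  linarith

/-- The coefficients, shifted by one. -/
def ec (k : ℕ) : ℚ :=
  (-1 : ℚ) ^ k * ((Nat.factorial (k + 1) : ℚ) * (Nat.factorial k : ℚ) /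
            (Nat.factorial (2 * (k + 1) + 1) : ℚ))

lemma ec_succ (k : ℕ) :
    ec (k + 1) * ((2 * k + 6) * (2 * k + 5)) = - (ec k * ((k + 1) * (k + 3))) := by
  unfold ec
  rw [show 2 * (k + 1 + 1) + 1 = 2 * (k + 1) + 1 + 1 + 1 by ring]
  have h := Nat.factorial_ne_zero (2 * (k + 1) + 1)
  rw [Nat.factorial_succ (2 * (k + 1) + 1 + 1), Nat.factorial_succ (2 * (k + 1) + 1),
    Nat.factorial_succ (k + 1), Nat.factorial_succ k]
  generalize (2 * (k + 1) + 1).factorial = A at *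
  have hA : (A : ℚ) ≠ 0 := by exact_mod_cast h
  push_cast
  field_simp
  ring

open Finset in
lemma main_sum (N d : ℕ) (hd : d ≤ N) :
    ∑ k ∈ range N, ec k * (R (d + 1) (k + 2) : ℚ) = 2 * d := by
  induction d with
  | zero =>
    simp only [Nat.cast_zero, mul_zero]
    apply sum_eq_zero
    intro k _
    rw [R_eq_zero _ _ (by omega)]
    simp
  | succ d ih =>
    have ih := ih (by omega)
    have h := sum_range_sub' (fun k => ec k * ((2 * k + 4) * (2 * k + 3))
      * (R (d + 1) (k + 1) : ℚ)) N
    rw [R_eq_zero d (N + 1) (by omega), R_one] at h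
    have e0 : ec 0 = 1 / 6 := by norm_num [ec, Nat.factorial]
    rw [e0] at h
    have h2 : ∑ k ∈ range N, ec k * (R (d + 1 + 1) (k + 2) : ℚ)
        = ∑ k ∈ range N, ec k * (R (d + 1) (k + 2) : ℚ) + 2 := by
      have h' : (2 : ℚ) = _ := Eq.trans (by norm_num) h.symm
      nth_rewrite 1 [h']
      rw [← sum_add_distrib]
      apply sum_congr rfl
      intro k _
      rw [R_succ (d + 1) (k + 1)]
      have := ec_succ k
      push_cast
      linear_combination (R (d + 1) (k + 2) : ℚ) * this
    rw [h2, ih]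
    push_cast
    ring

theorem stmt_19 (r : ℕ) (hr : 1 ≤ r) :
    ∑ j ∈ Finset.Icc 1 r, ∑ m ∈ Finset.Icc 1 j,
        (-1 : ℚ) ^ (m - 1) *
          ((Nat.factorial m : ℚ) * (Nat.factorial (m - 1) : ℚ) /
            (Nat.factorial (2 * m + 1) : ℚ)) *
          ((2 * r + 2).choose (2 * j) : ℚ) * (R j m : ℚ) = (r : ℚ) := by
  have step : ∀ j ∈ Finset.Icc 1 r, ∑ m ∈ Finset.Icc 1 j,
        (-1 : ℚ) ^ (m - 1) *
          ((Nat.factorial m : ℚ) * (Nat.factorial (m - 1) : ℚ) /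
            (Nat.factorial (2 * m + 1) : ℚ)) *
          ((2 * r + 2).choose (2 * j) : ℚ) * (R j m : ℚ)
      = ∑ k ∈ Finset.range r, ec k * ((2 * r + 2).choose (2 * j) : ℚ) * (R j (k + 1) : ℚ) := by
    intro j hj
    rw [Finset.mem_Icc] at hj
    have hs := Finset.sum_Ico_add'
      (fun k => ec (k - 1) * ((2 * r + 2).choose (2 * j) : ℚ) * (R j k : ℚ)) 0 r 1
    simp only [Nat.add_sub_cancel] at hs
    rw [Finset.range_eq_Ico, hs]
    apply Finset.sum_subset_zero_on_sdiff
    · intro m hm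
      simp only [Finset.mem_Icc, Finset.mem_Ico] at *
      omega
    · intro m hm
      simp only [Finset.mem_sdiff, Finset.mem_Icc, Finset.mem_Ico] at hm
      obtain ⟨j, rfl⟩ : ∃ k, j = k + 1 := ⟨j - 1, by omega⟩
      rw [R_eq_zero j m (by omega)]
      simp
    · intro m hm
      simp only [Finset.mem_Icc] at hm
      obtain ⟨m, rfl⟩ : ∃ k, m = k + 1 := ⟨m - 1, by omega⟩
      simp [ec]
  rw [Finset.sum_congr rfl step, Finset.sum_comm]
  have h2 : ∀ k ∈ Finset.range r, ∑ j ∈ Finset.Icc 1 r,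
      ec k * ((2 * r + 2).choose (2 * j) : ℚ) * (R j (k + 1) : ℚ)
      = ec k * (R (r + 1) (k + 2) : ℚ) / 2 := by
    intro k _
    rw [← R_binom]
    have : Finset.Icc 1 r = Finset.Ico (0 + 1) (r + 1) := by
      ext
      simp [Nat.lt_succ_iff]
    rw [this, ← Finset.sum_Ico_add', ← Finset.range_eq_Ico]
    push_cast
    simp only [mul_assoc, ← Finset.mul_sum]
    ring
  rw [Finset.sum_congr rfl h2, ← Finset.sum_div, main_sum r r le_rfl]
  ring
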